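/- arXiv:1312.4995 — 4 statements merged into one kernel-verified Lean document; each statement's English description precedes it below -/
import Mathlib

section
/- Let c : S¹ → ℝ² be a C² immersion and h : S¹ → ℝ^d a C² 2π-periodic map. Then the following three inequalities hold: (i) ‖h‖²_{L∞} ≤ (2/ℓ_c)·‖h‖²_{L²(ds)} + (ℓ_c/2)·‖D_s h‖²_{L²(ds)}; (ii) ‖D_s h‖²_{L∞} ≤ (ℓ_c/4)·‖D_s² h‖²_{L²(ds)}; (iii) ‖D_s h‖²_{L²(ds)} ≤ (ℓ_c²/4)·‖D_s² h‖²_{L²(ds)}. -/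
noncomputable section
open Real MeasureTheory intervalIntegral
open scoped RealInnerProductSpace

/-- We identify the plane with `EuclideanSpace ℝ (Fin 2)`. -/
abbrev R2 := EuclideanSpace ℝ (Fin 2)

/-- A smooth `2π`-periodic map, i.e. a smooth map on the circle `S¹`. -/
def SmoothLoop {E : Type*} [NormedAddCommGroup E] [NormedSpace ℝ E] (f : ℝ → E) : Prop :=
  ContDiff ℝ (⊤ : ℕ∞) f ∧ Function.Periodic f (2 * π)

/-- A smooth immersion `S¹ → ℝ²`: a smooth `2π`-periodic map with nowhere vanishing derivative. -/
def IsImmersion (c : ℝ → R2) : Prop :=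
  SmoothLoop c ∧ ∀ θ : ℝ, deriv c θ ≠ 0

/-- The speed `|c'|`. -/
def speed (c : ℝ → R2) (θ : ℝ) : ℝ := ‖deriv c θ‖

/-- Arc-length derivative `D_s = (1/|c'|) ∂_θ`. -/
def Ds {E : Type*} [NormedAddCommGroup E] [NormedSpace ℝ E] (c : ℝ → R2) (f : ℝ → E) :
    ℝ → E := fun θ => (speed c θ)⁻¹ • deriv f θ

/-- Unit tangent vector `v = c'/|c'|`. -/
def tangentV (c : ℝ → R2) (θ : ℝ) : R2 := (speed c θ)⁻¹ • deriv c θ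

/-- Rotation by `π/2` in the plane: `J(x,y) = (-y,x)`. -/
def Jrot (w : R2) : R2 := (WithLp.equiv 2 (Fin 2 → ℝ)).symm ![-(w 1), w 0]

/-- Unit normal vector `n = J v`. -/
def normalV (c : ℝ → R2) (θ : ℝ) : R2 := Jrot (tangentV c θ)

/-- Curvature `κ = ⟨D_s v, n⟩`. -/
def curv (c : ℝ → R2) (θ : ℝ) : ℝ := ⟪Ds c (tangentV c) θ, normalV c θ⟫

/-- `log |c'|`. -/
def logSpeed (c : ℝ → R2) (θ : ℝ) : ℝ := Real.log (speed c θ)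

/-- Length `ℓ_c = ∫_{S¹} |c'| dθ` of the curve. -/
def len (c : ℝ → R2) : ℝ := ∫ θ in (0:ℝ)..(2 * π), speed c θ

/-- A smooth path of immersions, parametrized by `[0,1]`. -/
def IsImmPath (c : ℝ → ℝ → R2) : Prop :=
  ContDiffOn ℝ (⊤ : ℕ∞) (fun p : ℝ × ℝ => c p.1 p.2) (Set.Icc 0 1 ×ˢ Set.univ) ∧
  ∀ t ∈ Set.Icc (0:ℝ) 1, IsImmersion (c t)

/-- Length `Len^G` of a path with respect to the metric `G`. -/
def pathLen (G : (ℝ → R2) → (ℝ → R2) → (ℝ → R2) → ℝ) (c : ℝ → ℝ → R2) : ℝ :=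
  ∫ t in (0:ℝ)..1,
    Real.sqrt (G (c t) (fun θ => deriv (fun τ => c τ θ) t) (fun θ => deriv (fun τ => c τ θ) t))

/-- Geodesic distance induced by `G`: the infimum of `Len^G` over smooth paths of immersions. -/
def distG (G : (ℝ → R2) → (ℝ → R2) → (ℝ → R2) → ℝ) (c₁ c₂ : ℝ → R2) : ℝ :=
  sInf { L : ℝ | ∃ c : ℝ → ℝ → R2, IsImmPath c ∧ c 0 = c₁ ∧ c 1 = c₂ ∧ L = pathLen G c }

/-- `G` assigns to every smooth immersion a nonnegative symmetric bilinear form on smooth maps. -/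
def IsMetric (G : (ℝ → R2) → (ℝ → R2) → (ℝ → R2) → ℝ) : Prop :=
  ∀ c : ℝ → R2, IsImmersion c →
    (∀ h k : ℝ → R2, SmoothLoop h → SmoothLoop k → G c h k = G c k h) ∧
    (∀ h₁ h₂ k : ℝ → R2, SmoothLoop h₁ → SmoothLoop h₂ → SmoothLoop k →
      G c (h₁ + h₂) k = G c h₁ k + G c h₂ k) ∧
    (∀ (a : ℝ) (h k : ℝ → R2), SmoothLoop h → SmoothLoop k →
      G c (a • h) k = a * G c h k) ∧
    (∀ h : ℝ → R2, SmoothLoop h → 0 ≤ G c h h)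

/-- The metric `G` is bounded below by the Sobolev `H^n(ds)` inner product:
`∫_{S¹} (|h|² + |D_s^n h|²) |c'| dθ ≤ A · G_c(h,h)`. -/
def SobolevBound (n : ℕ) (A : ℝ) (G : (ℝ → R2) → (ℝ → R2) → (ℝ → R2) → ℝ) : Prop :=
  ∀ c h : ℝ → R2, IsImmersion c → SmoothLoop h →
    (∫ θ in (0:ℝ)..(2 * π), (‖h θ‖ ^ 2 + ‖(Ds c)^[n] h θ‖ ^ 2) * speed c θ) ≤ A * G c h h

theorem osc_aux {E : Type*} [NormedAddCommGroup E] [NormedSpace ℝ E] [CompleteSpace E]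
    (f : ℝ → E) (hf : ContDiff ℝ 1 f) (hp : Function.Periodic f (2 * π)) (x y : ℝ) :
    ‖f x - f y‖ ≤ (∫ t in (0:ℝ)..(2 * π), ‖deriv f t‖) / 2 := by
  have hd : Continuous (deriv f) := hf.continuous_deriv le_rfl
  have hpd : Function.Periodic (fun t => ‖deriv f t‖) (2 * π) := by
    intro t
    have : (fun s => f (s + 2 * π)) = f := funext hp
    have h2 := deriv_comp_add_const f (2 * π) t
    rw [this] at h2
    simp only [h2]
  obtain ⟨z, hz, hfz⟩ := hp.exists_mem_Ico (by positivity) y x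
  rw [hfz]
  have ftc : ∀ a b, ∫ t in a..b, deriv f t = f b - f a := fun a b =>
    integral_deriv_eq_sub (fun t _ => (hf.differentiable (by norm_num)) t)
      (hd.intervalIntegrable _ _)
  have h1 : ‖f z - f x‖ ≤ ∫ t in x..z, ‖deriv f t‖ := by
    rw [← ftc]; exact norm_integral_le_integral_norm hz.1
  have h2 : ‖f (x + 2 * π) - f z‖ ≤ ∫ t in z..(x + 2 * π), ‖deriv f t‖ := by
    rw [← ftc]; exact norm_integral_le_integral_norm hz.2.le
  have h3 : (∫ t in x..z, ‖deriv f t‖) + ∫ t in z..(x + 2 * π), ‖deriv f t‖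
      = ∫ t in x..(x + 2 * π), ‖deriv f t‖ :=
    integral_add_adjacent_intervals (hd.norm.intervalIntegrable _ _)
      (hd.norm.intervalIntegrable _ _)
  have h4 := hpd.intervalIntegral_add_eq x 0
  rw [zero_add] at h4
  rw [hp x] at h2
  rw [norm_sub_rev] at h1
  linarith

theorem cs_aux (g w : ℝ → ℝ) (hg : Continuous g) (hw : Continuous w) (hw0 : ∀ x, 0 < w x) :
    (∫ t in (0:ℝ)..(2 * π), g t * w t) ^ 2
      ≤ (∫ t in (0:ℝ)..(2 * π), w t) * ∫ t in (0:ℝ)..(2 * π), g t ^ 2 * w t := by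
  have hpi : (0:ℝ) < 2 * π := by positivity
  set L := ∫ t in (0:ℝ)..(2 * π), w t with hL
  set M := ∫ t in (0:ℝ)..(2 * π), g t * w t with hM
  set N := ∫ t in (0:ℝ)..(2 * π), g t ^ 2 * w t with hN
  have hLpos : 0 < L :=
    intervalIntegral_pos_of_pos (hw.intervalIntegrable _ _) hw0 hpi
  have h0 : 0 ≤ ∫ t in (0:ℝ)..(2 * π), (L * g t - M) ^ 2 * w t :=
    integral_nonneg hpi.le fun t _ => mul_nonneg (sq_nonneg _) (hw0 t).le
  have e : (∫ t in (0:ℝ)..(2 * π), (L * g t - M) ^ 2 * w t)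
      = L ^ 2 * N - 2 * L * M * M + M ^ 2 * L := by
    have : (fun t => (L * g t - M) ^ 2 * w t)
      = fun t => L ^ 2 * (g t ^ 2 * w t) - 2 * L * M * (g t * w t) + M ^ 2 * w t := by
      funext t; ring
    rw [this, intervalIntegral.integral_add, intervalIntegral.integral_sub, intervalIntegral.integral_const_mul, intervalIntegral.integral_const_mul,
      intervalIntegral.integral_const_mul]
    all_goals exact Continuous.intervalIntegrable (by fun_prop) _ _
  rw [e] at h0
  have : 0 ≤ L * (L * N - M ^ 2) := by nlinarith
  nlinarith [nonneg_of_mul_nonneg_right this hLpos]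

theorem osc_sq {E : Type*} [NormedAddCommGroup E] [NormedSpace ℝ E] [CompleteSpace E]
    (c : ℝ → R2) (hw : Continuous (speed c)) (hw0 : ∀ x, 0 < speed c x)
    (f : ℝ → E) (hf : ContDiff ℝ 1 f) (hp : Function.Periodic f (2 * π)) :
    ((∫ t in (0:ℝ)..(2 * π), ‖deriv f t‖) / 2) ^ 2
      ≤ len c / 4 * ∫ t in (0:ℝ)..(2 * π), ‖Ds c f t‖ ^ 2 * speed c t := by
  have hd : Continuous (deriv f) := hf.continuous_deriv le_rfl
  have hD : Continuous (Ds c f) := (hw.inv₀ fun x => (hw0 x).ne').smul hd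
  have e : (fun t => ‖deriv f t‖) = fun t => ‖Ds c f t‖ * speed c t := by
    funext t
    have := (hw0 t)
    simp only [Ds, norm_smul, norm_inv, Real.norm_eq_abs, abs_of_pos this]
    field_simp
  have := cs_aux (fun t => ‖Ds c f t‖) (speed c) hD.norm hw hw0
  rw [e]
  unfold len
  nlinarith

/-- Poincaré inequalities with explicit constants depending only on `ℓ_c`. -/
theorem statement_4 (d : ℕ) (c : ℝ → R2)
    (hc : ContDiff ℝ 2 c) (hcper : Function.Periodic c (2 * π))
    (hcim : ∀ θ : ℝ, deriv c θ ≠ 0)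
    (h : ℝ → EuclideanSpace ℝ (Fin d))
    (hh : ContDiff ℝ 2 h) (hhper : Function.Periodic h (2 * π)) :
    (∀ θ : ℝ, ‖h θ‖ ^ 2
        ≤ 2 / len c * (∫ x in (0:ℝ)..(2 * π), ‖h x‖ ^ 2 * speed c x)
          + len c / 2 * (∫ x in (0:ℝ)..(2 * π), ‖Ds c h x‖ ^ 2 * speed c x)) ∧
    (∀ θ : ℝ, ‖Ds c h θ‖ ^ 2
        ≤ len c / 4 * (∫ x in (0:ℝ)..(2 * π), ‖(Ds c)^[2] h x‖ ^ 2 * speed c x)) ∧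
    (∫ x in (0:ℝ)..(2 * π), ‖Ds c h x‖ ^ 2 * speed c x)
        ≤ len c ^ 2 / 4 * (∫ x in (0:ℝ)..(2 * π), ‖(Ds c)^[2] h x‖ ^ 2 * speed c x) := by
  have hpi : (0:ℝ) < 2 * π := by positivity
  have hw0 : ∀ x, 0 < speed c x := fun x => norm_pos_iff.2 (hcim x)
  have hc1 : ContDiff ℝ 1 (deriv c) := ((contDiff_succ_iff_deriv (n := 1)).1 hc).2.2
  have hh1 : ContDiff ℝ 1 (deriv h) := ((contDiff_succ_iff_deriv (n := 1)).1 hh).2.2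
  have hs1 : ContDiff ℝ 1 (speed c) := hc1.norm ℝ hcim
  have hw : Continuous (speed c) := hs1.continuous
  have hu1 : ContDiff ℝ 1 (Ds c h) := (hs1.inv fun x => (hw0 x).ne').smul hh1
  have hhC : Continuous h := hh.continuous
  have huC : Continuous (Ds c h) := hu1.continuous
  have perd : ∀ {F : Type} [NormedAddCommGroup F] [NormedSpace ℝ F] (f : ℝ → F),
      Function.Periodic f (2 * π) → Function.Periodic (deriv f) (2 * π) := by
    intro F _ _ f hp t
    have : (fun s => f (s + 2 * π)) = f := funext hp
    have h2 := deriv_comp_add_const f (2 * π) t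
    rw [this] at h2
    exact h2.symm
  have hup : Function.Periodic (Ds c h) (2 * π) := by
    intro t
    simp only [Ds, speed, perd c hcper t, perd h hhper t]
  have hL : 0 < len c :=
    intervalIntegral_pos_of_pos (hw.intervalIntegrable _ _) hw0 hpi
  have hh1' : ContDiff ℝ 1 h := hh.of_le (by norm_num)
  have h2 : ∀ θ : ℝ, ‖Ds c h θ‖ ^ 2
        ≤ len c / 4 * (∫ x in (0:ℝ)..(2 * π), ‖(Ds c)^[2] h x‖ ^ 2 * speed c x) := by
    intro θ
    refine le_trans ?_ (osc_sq c hw hw0 (Ds c h) hu1 hup)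
    set K := (∫ t in (0:ℝ)..(2 * π), ‖deriv (Ds c h) t‖) / 2 with hK
    have hz : ∫ y in (0:ℝ)..(2 * π), speed c y • Ds c h y = 0 := by
      have e : (fun y => speed c y • Ds c h y) = deriv h := by
        funext y
        simp only [Ds, smul_smul, mul_inv_cancel₀ (hw0 y).ne', one_smul]
      rw [e, integral_deriv_eq_sub (fun t _ => (hh.differentiable (by norm_num)) t)
        (hh1.continuous.intervalIntegrable _ _)]
      have := hhper 0
      rw [zero_add] at this
      rw [this, sub_self]
    have e1 : ∫ y in (0:ℝ)..(2 * π), speed c y • (Ds c h θ - Ds c h y) = len c • Ds c h θ := by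
      simp only [smul_sub]
      rw [intervalIntegral.integral_sub, hz, sub_zero, intervalIntegral.integral_smul_const]
      · rfl
      all_goals exact Continuous.intervalIntegrable (by fun_prop) _ _
    have e2 : ‖len c • Ds c h θ‖ ≤ ∫ y in (0:ℝ)..(2 * π), speed c y * K := by
      rw [← e1]
      refine norm_integral_le_of_norm_le hpi.le ?_
        (Continuous.intervalIntegrable (by fun_prop) _ _)
      refine Filter.Eventually.of_forall fun y _ => ?_
      rw [norm_smul, Real.norm_eq_abs, abs_of_pos (hw0 y)]
      exact mul_le_mul_of_nonneg_left (osc_aux _ hu1 hup θ y) (hw0 y).le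
    rw [intervalIntegral.integral_mul_const, norm_smul, Real.norm_eq_abs, abs_of_pos hL] at e2
    have e3 : ‖Ds c h θ‖ ≤ K := le_of_mul_le_mul_left e2 hL
    gcongr
  refine ⟨?_, h2, ?_⟩
  · intro θ
    have hosc := osc_sq c hw hw0 h hh1' hhper
    set N := ∫ x in (0:ℝ)..(2 * π), ‖Ds c h x‖ ^ 2 * speed c x with hN
    have pt : ∀ y, ‖h θ‖ ^ 2 * speed c y
        ≤ 2 * (‖h y‖ ^ 2 * speed c y) + (len c / 2 * N) * speed c y := by
      intro y
      have a1 := osc_aux h hh1' hhper θ y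
      have a2 : ‖h θ - h y‖ ^ 2 ≤ len c / 4 * N := by
        refine le_trans ?_ hosc
        gcongr
      have a3 : ‖h θ‖ ≤ ‖h y‖ + ‖h θ - h y‖ := by
        have := norm_add_le (h y) (h θ - h y)
        rwa [add_sub_cancel] at this
      have a4 : ‖h θ‖ ^ 2 ≤ 2 * ‖h y‖ ^ 2 + len c / 2 * N := by
        nlinarith [norm_nonneg (h θ), sq_nonneg (‖h y‖ - ‖h θ - h y‖), norm_nonneg (h y), norm_nonneg (h θ - h y)]
      nlinarith [mul_le_mul_of_nonneg_right a4 (hw0 y).le]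
    have I := integral_mono_on (μ := volume) hpi.le
      (Continuous.intervalIntegrable (by fun_prop) _ _)
      (Continuous.intervalIntegrable (by fun_prop) _ _) (fun y _ => pt y)
    rw [intervalIntegral.integral_add (Continuous.intervalIntegrable (by fun_prop) _ _)
      (Continuous.intervalIntegrable (by fun_prop) _ _), intervalIntegral.integral_const_mul, intervalIntegral.integral_const_mul,
      intervalIntegral.integral_const_mul] at I
    change ‖h θ‖ ^ 2 * len c ≤ _ + _ * len c at I
    rw [← le_div_iff₀ hL] at I
    refine I.trans (le_of_eq ?_)
    field_simp
  · set N := ∫ x in (0:ℝ)..(2 * π), ‖(Ds c)^[2] h x‖ ^ 2 * speed c x with hN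
    have I := integral_mono_on (μ := volume) hpi.le
      (Continuous.intervalIntegrable (by fun_prop) _ _)
      (Continuous.intervalIntegrable (by fun_prop) _ _)
      (fun y _ => mul_le_mul_of_nonneg_right (h2 y) (hw0 y).le)
    rw [intervalIntegral.integral_const_mul] at I
    change _ ≤ _ * len c at I
    refine I.trans (le_of_eq ?_)
    ring
end
end

section
/- Let n ≥ 2, let c : S¹ → ℝ² be a smooth immersion and h : S¹ → ℝ^d a smooth 2π-periodic map. Then for every integer 0 ≤ k ≤ n: ‖D_s^k h‖²_{L²(ds)} ≤ ‖h‖²_{L²(ds)} + ‖D_s^n h‖²_{L²(ds)}. -/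
noncomputable section
open Real MeasureTheory intervalIntegral
open scoped RealInnerProductSpace

theorem aux_speed_smooth (c : ℝ → R2) (hc : IsImmersion c) :
    ContDiff ℝ (⊤ : ℕ∞) (speed c) := by
  have h1 : ContDiff ℝ (⊤ : ℕ∞) (deriv c) :=
    (contDiff_infty_iff_deriv.1 hc.1.1).2
  exact h1.norm ℝ hc.2

theorem aux_periodic_deriv {E : Type*} [NormedAddCommGroup E] [NormedSpace ℝ E]
    (f : ℝ → E) (T : ℝ) (hf : Function.Periodic f T) : Function.Periodic (deriv f) T := by
  intro x
  rw [← deriv_comp_add_const]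
  congr 1
  funext y
  exact hf y

theorem aux_Ds_loop {E : Type*} [NormedAddCommGroup E] [NormedSpace ℝ E]
    (c : ℝ → R2) (hc : IsImmersion c) (f : ℝ → E) (hf : SmoothLoop f) :
    SmoothLoop (Ds c f) := by
  constructor
  · have h1 : ContDiff ℝ (⊤ : ℕ∞) (deriv f) := (contDiff_infty_iff_deriv.1 hf.1).2
    exact ((aux_speed_smooth c hc).inv (fun x => norm_ne_zero_iff.2 (hc.2 x))).smul h1
  · intro x
    simp only [Ds, speed, aux_periodic_deriv f _ hf.2 x, aux_periodic_deriv c _ hc.1.2 x]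

theorem aux_convex (d : ℕ) (c : ℝ → R2) (hc : IsImmersion c)
    (u : ℝ → EuclideanSpace ℝ (Fin d)) (hu : SmoothLoop u) :
    2 * (∫ θ in (0:ℝ)..(2 * π), ‖Ds c u θ‖ ^ 2 * speed c θ)
      ≤ (∫ θ in (0:ℝ)..(2 * π), ‖u θ‖ ^ 2 * speed c θ)
        + ∫ θ in (0:ℝ)..(2 * π), ‖Ds c (Ds c u) θ‖ ^ 2 * speed c θ := by
  have hv := aux_Ds_loop c hc u hu
  have hw := aux_Ds_loop c hc _ hv
  have hs : Continuous (speed c) := (aux_speed_smooth c hc).continuous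
  have hpos : ∀ x, 0 < speed c x := fun x => norm_pos_iff.2 (hc.2 x)
  have hd : ∀ (f : ℝ → EuclideanSpace ℝ (Fin d)), SmoothLoop f → ∀ x,
      HasDerivAt f (speed c x • Ds c f x) x := by
    intro f hf x
    have := ((contDiff_infty_iff_deriv.1 hf.1).1 x).hasDerivAt
    simpa [Ds, smul_smul, (hpos x).ne'] using this
  have cu := hu.1.continuous
  have cv := hv.1.continuous
  have cw := hw.1.continuous
  set v := Ds c u
  set w := Ds c v
  have hF : ∫ θ in (0:ℝ)..(2 * π),
      (‖v θ‖ ^ 2 * speed c θ + ⟪u θ, w θ⟫ * speed c θ) = 0 := by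
    rw [intervalIntegral.integral_eq_sub_of_hasDerivAt (f := fun θ => ⟪u θ, v θ⟫)]
    · have h1 := hu.2 0
      have h2 := hv.2 0
      rw [zero_add] at h1 h2
      rw [h1, h2, sub_self]
    · intro x _
      have := (hd u hu x).inner ℝ (hd v hv x)
      refine HasDerivAt.congr_deriv this ?_
      change ⟪u x, speed c x • w x⟫ + ⟪speed c x • v x, v x⟫ = _
      rw [inner_smul_left, inner_smul_right, real_inner_self_eq_norm_sq]
      simp only [conj_trivial]
      ring
    · exact Continuous.intervalIntegrable (by fun_prop) _ _
  have hi : ∀ (f : ℝ → ℝ), Continuous f → IntervalIntegrable f volume 0 (2 * π) :=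
    fun f hf => hf.intervalIntegrable _ _
  rw [intervalIntegral.integral_add (hi _ (by fun_prop)) (hi _ (by fun_prop))] at hF
  have hG : 0 ≤ ∫ θ in (0:ℝ)..(2 * π),
      ((‖u θ‖ ^ 2 * speed c θ + ‖w θ‖ ^ 2 * speed c θ) + 2 * (⟪u θ, w θ⟫ * speed c θ)) := by
    apply intervalIntegral.integral_nonneg (by positivity)
    intro x _
    have h1 := norm_add_sq_real (u x) (w x)
    have h2 : 0 ≤ ‖u x + w x‖ ^ 2 * speed c x := mul_nonneg (sq_nonneg _) (hpos x).le
    rw [h1] at h2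
    linarith
  rw [intervalIntegral.integral_add (hi _ (by fun_prop)) (hi _ (by fun_prop)),
    intervalIntegral.integral_add (hi _ (by fun_prop)) (hi _ (by fun_prop)),
    intervalIntegral.integral_const_mul] at hG
  linarith

theorem aux_seq (a : ℕ → ℝ) (h0 : ∀ k, 0 ≤ a k) (h : ∀ k, 2 * a (k+1) ≤ a k + a (k+2))
    (n k : ℕ) (hk : k ≤ n) : a k ≤ a 0 + a n := by
  have hm : Monotone (fun k => a (k+1) - a k) :=
    monotone_nat_of_le_succ (fun k => by have := h k; show a (k+1) - a k ≤ a (k+2) - a (k+1); linarith)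
  rcases le_total (a k) (a (k+1)) with hc | hc
  · have : ∀ j, a k ≤ a (k + j) := by
      intro j
      induction j with
      | zero => exact le_rfl
      | succ j ih =>
        have := hm (Nat.le_add_right k j)
        simp only at this
        rw [← add_assoc]
        linarith
    have h1 := this (n - k)
    rw [Nat.add_sub_cancel' hk] at h1
    linarith [h0 0]
  · have : ∀ j, j ≤ k → a j ≤ a 0 := by
      intro j
      induction j with
      | zero => intro _; exact le_rfl
      | succ j ih =>
        intro hj
        have := hm (show j ≤ k by omega)
        simp only at this
        linarith [ih (by omega)]
    linarith [this k le_rfl, h0 n]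

/-- `‖D_s^k h‖²_{L²(ds)} ≤ ‖h‖²_{L²(ds)} + ‖D_s^n h‖²_{L²(ds)}` for `0 ≤ k ≤ n`. -/
theorem statement_5 (d n : ℕ) (hn : 2 ≤ n) (c : ℝ → R2) (hc : IsImmersion c)
    (h : ℝ → EuclideanSpace ℝ (Fin d)) (hh : SmoothLoop h) :
    ∀ k : ℕ, k ≤ n →
      (∫ θ in (0:ℝ)..(2 * π), ‖(Ds c)^[k] h θ‖ ^ 2 * speed c θ)
        ≤ (∫ θ in (0:ℝ)..(2 * π), ‖h θ‖ ^ 2 * speed c θ)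
          + ∫ θ in (0:ℝ)..(2 * π), ‖(Ds c)^[n] h θ‖ ^ 2 * speed c θ := by
  have hl : ∀ k, SmoothLoop ((Ds c)^[k] h) := by
    intro k
    induction k with
    | zero => exact hh
    | succ k ih =>
      rw [Function.iterate_succ_apply']
      exact aux_Ds_loop c hc _ ih
  intro k hk
  refine aux_seq (fun k => ∫ θ in (0:ℝ)..(2 * π), ‖(Ds c)^[k] h θ‖ ^ 2 * speed c θ)
    ?_ ?_ n k hk
  · intro k
    exact intervalIntegral.integral_nonneg (by positivity)
      (fun x _ => mul_nonneg (sq_nonneg _) (norm_nonneg _))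
  · intro k
    have := aux_convex d c hc _ (hl k)
    simpa only [Function.iterate_succ_apply'] using this
end
end

section
/- Let n ≥ 2, let c : S¹ → ℝ² be a smooth immersion and h : S¹ → ℝ^d a smooth 2π-periodic map. Then for every integer 0 ≤ k ≤ n the Gagliardo–Nirenberg interpolation inequality holds: ‖D_s^k h‖_{L²(ds)} ≤ ‖h‖_{L²(ds)}^{1−k/n} · ‖D_s^n h‖_{L²(ds)}^{k/n}. -/
noncomputable section
open Real MeasureTheory intervalIntegral
open scoped RealInnerProductSpace

theorem seq_interp (a : ℕ → ℝ) (h0 : ∀ k, 0 ≤ a k)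
    (hcx : ∀ k, a (k + 1) ^ 2 ≤ a k * a (k + 2)) (n k : ℕ) (hn : 0 < n) (hk : k ≤ n) :
    a k ≤ a 0 ^ ((1:ℝ) - (k:ℝ) / n) * a n ^ ((k:ℝ) / n) := by
  have hn' : (0:ℝ) < n := by exact_mod_cast hn
  rcases Nat.eq_zero_or_pos k with rfl | hk0
  · simp
  rcases hk.eq_or_lt with rfl | hkn
  · rw [div_self hn'.ne']; simp
  by_cases hpos : ∀ j, 0 < a j
  · set b : ℕ → ℝ := fun j => Real.log (a j) with hb
    have hd : ∀ j, b (j + 1) - b j ≤ b (j + 2) - b (j + 1) := by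
      intro j
      have h1 := Real.log_le_log (pow_pos (hpos (j + 1)) 2) (hcx j)
      rw [Real.log_pow, Real.log_mul (hpos _).ne' (hpos _).ne'] at h1
      simp only [hb]
      push_cast at h1
      linarith
    have hmono : Monotone (fun j => b (j + 1) - b j) := monotone_nat_of_le_succ hd
    have hlow : ∀ m, m ≤ k → b m - b 0 ≤ m * (b (k + 1) - b k) := by
      intro m
      induction m with
      | zero => intro _; simp
      | succ m ih =>
        intro hm
        have h1 := ih (by omega)
        have h2 := hmono (show m ≤ k by omega)
        simp only at h2
        push_cast
        linarith
    have hup : ∀ m : ℕ, (m:ℝ) * (b (k + 1) - b k) ≤ b (k + m) - b k := by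
      intro m
      induction m with
      | zero => simp
      | succ m ih =>
        have h2 := hmono (show k ≤ k + m by omega)
        simp only at h2
        push_cast
        rw [← add_assoc]
        linarith
    have h1 := hlow k le_rfl
    obtain ⟨m, rfl⟩ := Nat.exists_eq_add_of_le hk
    have h2 := hup m
    have hm : (0:ℝ) ≤ m := by positivity
    have hkk : (0:ℝ) ≤ k := by positivity
    have h3 := mul_le_mul_of_nonneg_left h1 hm
    have h4 := mul_le_mul_of_nonneg_left h2 hkk
    push_cast at hn' ⊢
    have key : b k ≤ (1 - (k:ℝ) / (k + m)) * b 0 + (k:ℝ) / (k + m) * b (k + m) := by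
      have : (1 - (k:ℝ) / (k + m)) * b 0 + (k:ℝ) / (k + m) * b (k + m)
          = (m * b 0 + k * b (k + m)) / (k + m) := by
        field_simp
        ring
      rw [this, le_div_iff₀ hn']
      linarith
    rw [Real.rpow_def_of_pos (hpos _), Real.rpow_def_of_pos (hpos _), ← Real.exp_add,
      ← Real.log_le_iff_le_exp (hpos _)]
    simp only [hb] at key
    linarith
  · push Not at hpos
    obtain ⟨j, hj⟩ := hpos
    have hj : a j = 0 := le_antisymm hj (h0 j)
    have hup : ∀ i, a i = 0 → a (i + 1) = 0 := by
      intro i hi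
      have := hcx i
      rw [hi, zero_mul] at this
      exact pow_eq_zero_iff (two_ne_zero) |>.1 (le_antisymm this (sq_nonneg _))
    have hdn : ∀ i, a (i + 2) = 0 → a (i + 1) = 0 := by
      intro i hi
      have := hcx i
      rw [hi, mul_zero] at this
      exact pow_eq_zero_iff (two_ne_zero) |>.1 (le_antisymm this (sq_nonneg _))
    have h1 : a 1 = 0 := by
      have : ∀ i, a i = 0 → a 1 = 0 := by
        intro i
        induction i with
        | zero => intro h; exact hup 0 h
        | succ i ih =>
          intro h
          rcases i with _ | i
          · exact h
          · exact ih (hdn i h)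
      exact this j hj
    have hall : ∀ i, a (i + 1) = 0 := by
      intro i
      induction i with
      | zero => exact h1
      | succ i ih => exact hup _ ih
    obtain ⟨i, rfl⟩ := Nat.exists_eq_succ_of_ne_zero hk0.ne'
    rw [Nat.succ_eq_add_one, hall i]
    exact mul_nonneg (Real.rpow_nonneg (h0 _) _) (Real.rpow_nonneg (h0 _) _)

theorem speed_pos {c : ℝ → R2} (hc : IsImmersion c) (θ : ℝ) : 0 < speed c θ :=
  norm_pos_iff.2 (hc.2 θ)

theorem deriv_smoothLoop {E : Type*} [NormedAddCommGroup E] [NormedSpace ℝ E] {f : ℝ → E}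
    (hf : SmoothLoop f) : SmoothLoop (deriv f) := by
  refine ⟨((contDiff_infty_iff_deriv (f := f)).1 hf.1).2, fun θ => ?_⟩
  rw [← deriv_comp_add_const]
  congr 1
  exact funext hf.2

theorem speed_smoothLoop {c : ℝ → R2} (hc : IsImmersion c) : SmoothLoop (speed c) := by
  have h := deriv_smoothLoop hc.1
  refine ⟨h.1.norm ℝ hc.2, fun θ => ?_⟩
  simp only [speed, h.2 θ]

theorem Ds_smoothLoop {E : Type*} [NormedAddCommGroup E] [NormedSpace ℝ E] {c : ℝ → R2}
    (hc : IsImmersion c) {f : ℝ → E} (hf : SmoothLoop f) : SmoothLoop (Ds c f) := by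
  have h := deriv_smoothLoop hf
  have hs := speed_smoothLoop hc
  refine ⟨(hs.1.inv fun θ => (speed_pos hc θ).ne').smul h.1, fun θ => ?_⟩
  simp only [Ds, h.2 θ, hs.2 θ]

theorem interp_step {d : ℕ} {c : ℝ → R2} (hc : IsImmersion c)
    {f : ℝ → EuclideanSpace ℝ (Fin d)} (hf : SmoothLoop f) :
    (∫ θ in (0:ℝ)..(2 * π), ‖Ds c f θ‖ ^ 2 * speed c θ) ^ 2 ≤
      (∫ θ in (0:ℝ)..(2 * π), ‖f θ‖ ^ 2 * speed c θ) *
        ∫ θ in (0:ℝ)..(2 * π), ‖Ds c (Ds c f) θ‖ ^ 2 * speed c θ := by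
  have hg := Ds_smoothLoop hc hf
  have hk := Ds_smoothLoop hc hg
  have hs := speed_smoothLoop hc
  have cf := hf.1.continuous
  have cg := hg.1.continuous
  have ck := hk.1.continuous
  have cs := hs.1.continuous
  have hdf : ∀ θ, HasDerivAt f (speed c θ • Ds c f θ) θ := by
    intro θ
    have : speed c θ • Ds c f θ = deriv f θ := by
      simp only [Ds]; rw [smul_inv_smul₀ (speed_pos hc θ).ne']
    rw [this]
    exact (hf.1.differentiable (by simp) θ).hasDerivAt
  have hdg : ∀ θ, HasDerivAt (Ds c f) (speed c θ • Ds c (Ds c f) θ) θ := by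
    intro θ
    have : speed c θ • Ds c (Ds c f) θ = deriv (Ds c f) θ := by
      rw [Ds, smul_inv_smul₀ (speed_pos hc θ).ne']
    rw [this]
    exact (hg.1.differentiable (by simp) θ).hasDerivAt
  have hd : ∀ θ, HasDerivAt (fun θ => ⟪f θ, Ds c f θ⟫)
      (⟪f θ, Ds c (Ds c f) θ⟫ * speed c θ + ‖Ds c f θ‖ ^ 2 * speed c θ) θ := by
    intro θ
    refine HasDerivAt.congr_deriv ((hdf θ).inner ℝ (hdg θ)) ?_
    rw [inner_smul_right, inner_smul_left, real_inner_self_eq_norm_sq]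
    simp only [conj_trivial]
    ring
  have i0 : IntervalIntegrable (fun θ => ‖f θ‖ ^ 2 * speed c θ) volume 0 (2 * π) :=
    (by fun_prop : Continuous _).intervalIntegrable _ _
  have i1 : IntervalIntegrable (fun θ => ‖Ds c f θ‖ ^ 2 * speed c θ) volume 0 (2 * π) :=
    (by fun_prop : Continuous _).intervalIntegrable _ _
  have i2 : IntervalIntegrable (fun θ => ‖Ds c (Ds c f) θ‖ ^ 2 * speed c θ) volume 0 (2 * π) :=
    (by fun_prop : Continuous _).intervalIntegrable _ _
  have i3 : IntervalIntegrable (fun θ => ⟪f θ, Ds c (Ds c f) θ⟫ * speed c θ) volume 0 (2 * π) :=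
    ((cf.inner ck).mul cs).intervalIntegrable _ _
  have ibp := integral_eq_sub_of_hasDerivAt (fun θ _ => hd θ) (i3.add i1)
  have p1 : f (2 * π) = f 0 := by simpa using hf.2 0
  have p2 : Ds c f (2 * π) = Ds c f 0 := by simpa using hg.2 0
  rw [p1, p2, sub_self, integral_add i3 i1] at ibp
  have hq : ∀ x : ℝ, 0 ≤ (∫ θ in (0:ℝ)..(2 * π), ‖f θ‖ ^ 2 * speed c θ) * (x * x)
      + (2 * ∫ θ in (0:ℝ)..(2 * π), ⟪f θ, Ds c (Ds c f) θ⟫ * speed c θ) * x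
      + ∫ θ in (0:ℝ)..(2 * π), ‖Ds c (Ds c f) θ‖ ^ 2 * speed c θ := by
    intro x
    have hnn : 0 ≤ ∫ θ in (0:ℝ)..(2 * π), ‖x • f θ + Ds c (Ds c f) θ‖ ^ 2 * speed c θ :=
      integral_nonneg (by positivity) fun θ _ => mul_nonneg (sq_nonneg _) (speed_pos hc θ).le
    have he : ∀ θ, ‖x • f θ + Ds c (Ds c f) θ‖ ^ 2 * speed c θ
        = ((x * x) * (‖f θ‖ ^ 2 * speed c θ)
          + (2 * x) * (⟪f θ, Ds c (Ds c f) θ⟫ * speed c θ))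
          + ‖Ds c (Ds c f) θ‖ ^ 2 * speed c θ := by
      intro θ
      rw [norm_add_sq_real, inner_smul_left, norm_smul, mul_pow, Real.norm_eq_abs, sq_abs]
      simp only [conj_trivial]
      ring
    simp_rw [he] at hnn
    rw [integral_add ((i0.const_mul _).add (i3.const_mul _)) i2,
      integral_add (i0.const_mul _) (i3.const_mul _), intervalIntegral.integral_const_mul,
      intervalIntegral.integral_const_mul] at hnn
    linarith
  have := discrim_le_zero hq
  rw [discrim, eq_neg_of_add_eq_zero_left ibp] at this
  nlinarith

/-- Gagliardo–Nirenberg interpolation inequality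
`‖D_s^k h‖_{L²(ds)} ≤ ‖h‖_{L²(ds)}^{1−k/n} ‖D_s^n h‖_{L²(ds)}^{k/n}` for `0 ≤ k ≤ n`. -/
theorem statement_6 (d n : ℕ) (hn : 2 ≤ n) (c : ℝ → R2) (hc : IsImmersion c)
    (h : ℝ → EuclideanSpace ℝ (Fin d)) (hh : SmoothLoop h) :
    ∀ k : ℕ, k ≤ n →
      Real.sqrt (∫ θ in (0:ℝ)..(2 * π), ‖(Ds c)^[k] h θ‖ ^ 2 * speed c θ)
        ≤ Real.sqrt (∫ θ in (0:ℝ)..(2 * π), ‖h θ‖ ^ 2 * speed c θ) ^ ((1:ℝ) - (k:ℝ) / n)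
          * Real.sqrt (∫ θ in (0:ℝ)..(2 * π), ‖(Ds c)^[n] h θ‖ ^ 2 * speed c θ) ^ ((k:ℝ) / n) := by
  intro k hk
  refine seq_interp (fun j => Real.sqrt (∫ θ in (0:ℝ)..(2 * π), ‖(Ds c)^[j] h θ‖ ^ 2 * speed c θ))
    (fun j => Real.sqrt_nonneg _) (fun j => ?_) n k (by omega) hk
  have hsm : ∀ j, SmoothLoop ((Ds c)^[j] h) := by
    intro j
    induction j with
    | zero => exact hh
    | succ j ih => rw [Function.iterate_succ_apply']; exact Ds_smoothLoop hc ih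
  have hnn : ∀ j, 0 ≤ ∫ θ in (0:ℝ)..(2 * π), ‖(Ds c)^[j] h θ‖ ^ 2 * speed c θ := fun j =>
    integral_nonneg (by positivity) fun θ _ => mul_nonneg (sq_nonneg _) (speed_pos hc θ).le
  have h1 := interp_step hc (hsm j)
  rw [← Function.iterate_succ_apply' (Ds c), ← Function.iterate_succ_apply' (Ds c)] at h1
  rw [Real.sq_sqrt (hnn _), ← Real.sqrt_mul (hnn _)]
  exact Real.le_sqrt_of_sq_le h1
end
end

section
/- Let I ⊆ ℝ be an open interval, let c : I × S¹ → ℝ² be a smooth map such that each c(t,·) is a smooth immersion, and let F : I × S¹ → ℝ^d be smooth and 2π-periodic in the second variable. Then for all (t,θ): ∂_t (D_s F)(t,θ) = D_s(∂_t F)(t,θ) − ⟨D_s(∂_t c)(t,θ), v(t,θ)⟩ · (D_s F)(t,θ), where D_s = (1/|∂_θ c(t,·)|)∂_θ and v = ∂_θ c / |∂_θ c| are computed from the curve c(t,·). -/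
noncomputable section
open Real MeasureTheory intervalIntegral
open scoped RealInnerProductSpace

theorem hasDerivAt_clm_eval {V E : Type*} [NormedAddCommGroup V] [NormedSpace ℝ V]
    [NormedAddCommGroup E] [NormedSpace ℝ E] (A : V → V →L[ℝ] E) (A' : V →L[ℝ] V →L[ℝ] E)
    (g : ℝ → V) (g' : V) (t : ℝ) (v : V) (hA : HasFDerivAt A A' (g t)) (hg : HasDerivAt g g' t) :
    HasDerivAt (fun τ => A (g τ) v) (A' g' v) t :=
  (ContinuousLinearMap.apply ℝ E v).hasFDerivAt.comp_hasDerivAt t (hA.comp_hasDerivAt t hg)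

theorem hasDerivAt_mixed {E : Type*} [NormedAddCommGroup E] [NormedSpace ℝ E]
    (I : Set ℝ) (hI : IsOpen I) (f : ℝ → ℝ → E)
    (hf : ContDiffOn ℝ (⊤ : ℕ∞) (fun p : ℝ × ℝ => f p.1 p.2) (I ×ˢ Set.univ))
    (t : ℝ) (ht : t ∈ I) (θ : ℝ) :
    HasDerivAt (fun τ => deriv (f τ) θ) (deriv (fun x => deriv (fun τ => f τ x) t) θ) t := by
  obtain ⟨G, hG⟩ : ∃ G : ℝ × ℝ → E, G = fun p => f p.1 p.2 := ⟨_, rfl⟩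
  rw [← hG] at hf
  have hfG : f = fun τ x => G (τ, x) := by rw [hG]
  clear hG
  subst hfG
  have h22 : (2 : WithTop ℕ∞) ≤ ((⊤ : ℕ∞) : WithTop ℕ∞) :=
    WithTop.coe_le_coe.2 (le_top : (2 : ℕ∞) ≤ ⊤)
  have hat : ∀ τ ∈ I, ∀ x, ContDiffAt ℝ (⊤ : ℕ∞) G (τ, x) := fun τ hτ x =>
    hf.contDiffAt ((hI.prod isOpen_univ).mem_nhds ⟨hτ, Set.mem_univ _⟩)
  have hd : ∀ τ ∈ I, ∀ x, HasFDerivAt G (fderiv ℝ G (τ, x)) (τ, x) := fun τ hτ x =>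
    ((hat τ hτ x).differentiableAt (by simp)).hasFDerivAt
  have l1 : ∀ τ x : ℝ, HasDerivAt (fun y : ℝ => (τ, y)) ((0 : ℝ), (1 : ℝ)) x := fun τ x =>
    (hasDerivAt_const x τ).prodMk (hasDerivAt_id x)
  have l2 : ∀ τ x : ℝ, HasDerivAt (fun σ : ℝ => (σ, x)) ((1 : ℝ), (0 : ℝ)) τ := fun τ x =>
    (hasDerivAt_id τ).prodMk (hasDerivAt_const τ x)
  have e1 : ∀ τ ∈ I, ∀ x, deriv (fun y => G (τ, y)) x = fderiv ℝ G (τ, x) (0, 1) := by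
    intro τ hτ x
    have := (hd τ hτ x).comp_hasDerivAt x (l1 τ x)
    exact this.deriv
  have e2 : ∀ x, deriv (fun τ => G (τ, x)) t = fderiv ℝ G (t, x) (1, 0) := by
    intro x
    have := (hd t ht x).comp_hasDerivAt t (l2 t x)
    exact this.deriv
  have h2 : HasFDerivAt (fderiv ℝ G) (fderiv ℝ (fderiv ℝ G) (t, θ)) (t, θ) :=
    (((hat t ht θ).fderiv_right (m := 1) (by rw [one_add_one_eq_two]; exact h22)).differentiableAt
      (by simp)).hasFDerivAt
  have hsymm : IsSymmSndFDerivAt ℝ G (t, θ) :=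
    (hat t ht θ).isSymmSndFDerivAt (by simpa using h22)
  have a1 := hasDerivAt_clm_eval (fderiv ℝ G) _ _ _ t (0, 1) h2 (l2 t θ)
  have a2 := hasDerivAt_clm_eval (fderiv ℝ G) _ _ _ θ (1, 0) h2 (l1 t θ)
  have e3 : (fun x => deriv (fun τ => G (τ, x)) t) = fun x => fderiv ℝ G (t, x) (1, 0) := funext e2
  have a3 : deriv (fun x => deriv (fun τ => G (τ, x)) t) θ
      = fderiv ℝ (fderiv ℝ G) (t, θ) (1, 0) (0, 1) := by
    rw [e3, hsymm.eq]
    exact a2.deriv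
  rw [a3]
  refine a1.congr_of_eventuallyEq ?_
  filter_upwards [hI.mem_nhds ht] with τ hτ using e1 τ hτ θ

/-- the commutation formula
`∂_t (D_s F) = D_s(∂_t F) − ⟨D_s(∂_t c), v⟩ D_s F` for a time-dependent curve. -/
theorem statement_8 (d : ℕ) (I : Set ℝ) (hI : IsOpen I) (hIconn : I.OrdConnected)
    (c : ℝ → ℝ → R2)
    (hc : ContDiffOn ℝ (⊤ : ℕ∞) (fun p : ℝ × ℝ => c p.1 p.2) (I ×ˢ Set.univ))
    (hcim : ∀ t ∈ I, IsImmersion (c t))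
    (F : ℝ → ℝ → EuclideanSpace ℝ (Fin d))
    (hF : ContDiffOn ℝ (⊤ : ℕ∞) (fun p : ℝ × ℝ => F p.1 p.2) (I ×ˢ Set.univ))
    (hFper : ∀ t ∈ I, Function.Periodic (F t) (2 * π)) :
    ∀ t ∈ I, ∀ θ : ℝ,
      deriv (fun τ => Ds (c τ) (F τ) θ) t
        = Ds (c t) (fun x => deriv (fun τ => F τ x) t) θ
          - (⟪Ds (c t) (fun x => deriv (fun τ => c τ x) t) θ, tangentV (c t) θ⟫ : ℝ) •
              Ds (c t) (F t) θ := by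
  intro t ht θ
  have h1 := hasDerivAt_mixed I hI c hc t ht θ
  have h2 := hasDerivAt_mixed I hI F hF t ht θ
  have hne : deriv (c t) θ ≠ 0 := (hcim t ht).2 θ
  have hn : ‖deriv (c t) θ‖ ≠ 0 := norm_ne_zero_iff.mpr hne
  set C := deriv (fun x => deriv (fun τ => c τ x) t) θ with hC
  have hsq := h1.norm_sq
  have h3 : HasDerivAt (fun τ => ‖deriv (c τ) θ‖)
      (⟪deriv (c t) θ, C⟫ / ‖deriv (c t) θ‖) t := by
    have := hsq.sqrt (pow_ne_zero 2 hn)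
    simp only [Real.sqrt_sq (norm_nonneg _)] at this
    convert this using 1
    field_simp
  have h4 := ((h3.inv hn).smul h2).deriv
  simp only [Ds, tangentV, speed]
  refine h4.trans ?_
  rw [← hC, real_inner_smul_left, real_inner_smul_right, real_inner_comm, smul_smul,
    sub_eq_add_neg, ← neg_smul]
  congr 2
  field_simp
end
end
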